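/- arXiv:0805.1190 — 6 statements merged into one kernel-verified Lean document; each statement's English description precedes it below -/
import Mathlib

section
/- Let D be an orthogonal projection on H and let φ ∈ H with ‖φ‖ = 1 and ‖(I − D)φ‖ ≤ 1/2. Then Dφ ≠ 0, and the normalized projection ψ̃ := Dφ/‖Dφ‖ satisfies ‖φ − ψ̃ − (I − D)φ‖ ≤ ‖(I − D)φ‖². That is, φ − ψ̃ agrees with (I − D)φ up to an error quadratic in ‖(I − D)φ‖. -/
open RealInnerProductSpace

/- STATEMENT 4: If D is an orthogonal projection on H, ‖φ‖ = 1 and ‖(I − D)φ‖ ≤ 1/2, then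
Dφ ≠ 0 and the normalized projection ψ̃ = Dφ/‖Dφ‖ satisfies
‖φ − ψ̃ − (I − D)φ‖ ≤ ‖(I − D)φ‖². -/
theorem normalized_projection_quadratic_error
    {H : Type*} [NormedAddCommGroup H] [InnerProductSpace ℝ H] [CompleteSpace H]
    (D : H →L[ℝ] H)
    (hD_idem : ∀ x, D (D x) = D x)
    (hD_sa : ∀ x y, ⟪D x, y⟫ = ⟪x, D y⟫)
    (φ : H) (hφ : ‖φ‖ = 1) (hclose : ‖φ - D φ‖ ≤ 1 / 2) :
    D φ ≠ 0 ∧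
    ‖φ - ‖D φ‖⁻¹ • D φ - (φ - D φ)‖ ≤ ‖φ - D φ‖ ^ 2 := by
  have inner_self : ⟪φ, D φ⟫ = ‖D φ‖ ^ 2 := by
    rw [← real_inner_self_eq_norm_sq, hD_sa, hD_idem]
  have pythagoras : ‖φ - D φ‖ ^ 2 = 1 - ‖D φ‖ ^ 2 := by
    rw [norm_sub_sq_real, inner_self, hφ]
    ring
  have norm_nonneg_D : 0 ≤ ‖D φ‖ := norm_nonneg _
  have norm_le_one : ‖D φ‖ ≤ 1 := by nlinarith [sq_nonneg ‖φ - D φ‖]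
  have norm_ne_zero : ‖D φ‖ ≠ 0 := by
    intro h
    rw [h] at pythagoras
    nlinarith [norm_nonneg (φ - D φ)]
  refine ⟨norm_ne_zero_iff.mp norm_ne_zero, ?_⟩
  have error_eq : φ - ‖D φ‖⁻¹ • D φ - (φ - D φ) = (1 - ‖D φ‖⁻¹) • D φ := by
    module
  calc ‖φ - ‖D φ‖⁻¹ • D φ - (φ - D φ)‖
      = |(1 - ‖D φ‖⁻¹) * ‖D φ‖| := by
        rw [error_eq, norm_smul, Real.norm_eq_abs, abs_mul, abs_norm]
    _ = 1 - ‖D φ‖ := by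
        rw [sub_mul, inv_mul_cancel₀ norm_ne_zero, one_mul, abs_sub_comm,
          abs_of_nonneg (sub_nonneg.mpr norm_le_one)]
    _ ≤ ‖φ - D φ‖ ^ 2 := by
        rw [pythagoras]
        nlinarith
end

section
/- Let E be a finite-dimensional real inner product space of dimension n, let A : E → E be a symmetric (self-adjoint) linear map with eigenvalues λ_1 ≤ λ_2 ≤ … ≤ λ_n listed with multiplicity, and let N ≤ n. Then for every orthonormal N-tuple Φ = (φ_1,…,φ_N) in E one has ∑_{i=1}^N ⟨Aφ_i,φ_i⟩ ≥ ∑_{k=1}^N λ_k, and equality is attained when (φ_1,…,φ_N) is an orthonormal system of eigenvectors of A corresponding to the eigenvalues λ_1,…,λ_N. Hence the minimum of the functional J_A(Φ) := ∑_{i=1}^N ⟨Aφ_i,φ_i⟩ over all orthonormal N-tuples equals the sum of the N lowest eigenvalues of A. -/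
open RealInnerProductSpace

/-- For a monotone sequence, weights in `[0, 1]` of total mass `N` give a weighted sum that is at
least the sum of the first `N` terms. -/
theorem sum_castLE_le_sum_mul_of_monotone {n N : ℕ} (hN : N ≤ n) {μ w : Fin n → ℝ}
    (hμ : Monotone μ) (hw₀ : ∀ k, 0 ≤ w k) (hw₁ : ∀ k, w k ≤ 1) (hw : ∑ k, w k = N) :
    ∑ i : Fin N, μ (Fin.castLE hN i) ≤ ∑ k, w k * μ k := by
  obtain ⟨c, hc_lt, hc_ge⟩ : ∃ c, (∀ k : Fin n, (k : ℕ) < N → μ k ≤ c) ∧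
      ∀ k : Fin n, N ≤ (k : ℕ) → c ≤ μ k := by
    rcases hN.lt_or_eq with h | rfl
    · exact ⟨μ ⟨N, h⟩, fun k hk => hμ (Fin.le_def.2 hk.le), fun k hk => hμ (Fin.le_def.2 hk)⟩
    · obtain ⟨c, hc⟩ := (Set.finite_range μ).bddAbove
      exact ⟨c, fun k _ => hc ⟨k, rfl⟩, fun k hk => absurd k.isLt hk.not_gt⟩
  have hsum : ∑ i : Fin N, (μ (Fin.castLE hN i) - c) =
      ∑ k : Fin n, if (k : ℕ) < N then μ k - c else 0 := by
    refine Finset.sum_of_injOn (Fin.castLE hN) (Fin.castLE_injective hN).injOn (by simp) ?_ ?_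
    · intro k _ hk
      rw [if_neg fun h => hk ⟨⟨k, h⟩, by simp, rfl⟩]
    · intro i _
      simp
  have hle : ∑ k : Fin n, (if (k : ℕ) < N then μ k - c else 0) ≤ ∑ k, w k * (μ k - c) := by
    refine Finset.sum_le_sum fun k _ => ?_
    split_ifs with h
    · nlinarith [hc_lt k h, hw₁ k]
    · exact mul_nonneg (hw₀ k) (sub_nonneg.2 (hc_ge k (not_lt.1 h)))
  rw [← hsum] at hle
  simp only [mul_sub, Finset.sum_sub_distrib, ← Finset.sum_mul, hw, Finset.sum_const,
    Finset.card_univ, Fintype.card_fin, nsmul_eq_mul] at hle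
  linarith

/-- The quadratic form of a map diagonal in an orthonormal basis. -/
theorem OrthonormalBasis.inner_map_self_eq_sum_sq_mul {ι E : Type*} [Fintype ι]
    [NormedAddCommGroup E] [InnerProductSpace ℝ E] (e : OrthonormalBasis ι ℝ E)
    {A : E →ₗ[ℝ] E} {μ : ι → ℝ} (he : ∀ k, A (e k) = μ k • e k) (x : E) :
    ⟪A x, x⟫ = ∑ k, ⟪e k, x⟫ ^ 2 * μ k := by
  conv_lhs => enter [2, 2]; rw [← e.sum_repr' x]
  simp only [map_sum, map_smul, he, sum_inner, real_inner_smul_left]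
  exact Finset.sum_congr rfl fun k _ => by ring

/- STATEMENT 5: For a symmetric map A on an n-dimensional real inner product space with
eigenvalues μ_0 ≤ … ≤ μ_{n-1} (given by an orthonormal eigenbasis e), every orthonormal
N-tuple Φ satisfies ∑ ⟨Aφ_i,φ_i⟩ ≥ ∑ of the N lowest eigenvalues, with equality for any
orthonormal system of eigenvectors corresponding to the N lowest eigenvalues. -/
theorem trace_min_sum_lowest_eigenvalues
    {E : Type*} [NormedAddCommGroup E] [InnerProductSpace ℝ E] [FiniteDimensional ℝ E]
    {n : ℕ} (hn : Module.finrank ℝ E = n)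
    (A : E →ₗ[ℝ] E) (hA : LinearMap.IsSymmetric A)
    (μ : Fin n → ℝ) (hμ : Monotone μ)
    (e : OrthonormalBasis (Fin n) ℝ E) (he : ∀ k, A (e k) = μ k • e k)
    {N : ℕ} (hN : N ≤ n) :
    (∀ Φ : Fin N → E, Orthonormal ℝ Φ →
        ∑ i, ⟪A (Φ i), Φ i⟫ ≥ ∑ i : Fin N, μ (Fin.castLE hN i)) ∧
    (∀ Φ : Fin N → E, Orthonormal ℝ Φ →
        (∀ i, A (Φ i) = μ (Fin.castLE hN i) • Φ i) →
        ∑ i, ⟪A (Φ i), Φ i⟫ = ∑ i : Fin N, μ (Fin.castLE hN i)) := by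
  refine ⟨fun Φ hΦ => ?_, fun Φ hΦ h => ?_⟩
  · have hsq : ∀ i, ∑ k, ⟪e k, Φ i⟫ ^ 2 = 1 := fun i => by
      simpa [hΦ.1 i] using e.sum_sq_norm_inner_right (Φ i)
    simp only [e.inner_map_self_eq_sum_sq_mul he]
    rw [Finset.sum_comm]
    simp only [← Finset.sum_mul]
    refine sum_castLE_le_sum_mul_of_monotone hN hμ
      (fun k => Finset.sum_nonneg fun i _ => sq_nonneg _) (fun k => ?_) ?_
    · simpa [real_inner_comm] using hΦ.sum_inner_products_le (s := Finset.univ) (e k)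
    · rw [Finset.sum_comm]
      simp [hsq]
  · refine Finset.sum_congr rfl fun i _ => ?_
    rw [h i, real_inner_smul_left, real_inner_self_eq_norm_sq, hΦ.1 i]
    simp
end

section
/- Let E be a finite-dimensional real inner product space of dimension n > N, let A : E → E be a symmetric (self-adjoint) linear map with eigenvalues λ_1 ≤ … ≤ λ_n listed with multiplicity, and assume the gap condition λ_N < λ_{N+1}. If Φ = (φ_1,…,φ_N) is an orthonormal N-tuple attaining the minimum of J_A, i.e. ∑_{i=1}^N ⟨Aφ_i,φ_i⟩ = ∑_{k=1}^N λ_k, then span{φ_1,…,φ_N} equals the span of all eigenvectors of A with eigenvalue at most λ_N (the unique A-invariant subspace spanned by eigenvectors corresponding to the N lowest eigenvalues). In particular, the minimizer is unique up to orthogonal transformations of the tuple. -/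
open RealInnerProductSpace

/-- A sum over the first `N` indices, as a sum over all indices with an indicator weight. -/
lemma Fin.sum_castLE_eq_sum_mul_ite {n N : ℕ} (hN : N ≤ n) (f : Fin n → ℝ) :
    ∑ i : Fin N, f (Fin.castLE hN i) = ∑ k : Fin n, f k * (if (k : ℕ) < N then 1 else 0) := by
  refine Finset.sum_of_injOn (Fin.castLE hN) (Fin.castLE_injective hN).injOn
    (fun _ _ => Finset.mem_coe.2 (Finset.mem_univ _)) ?_ ?_
  · intro k _ hk
    have hkN : ¬ (k : ℕ) < N := fun h => hk ⟨⟨k, h⟩, by simp, rfl⟩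
    simp [hkN]
  · intro i _
    simp

/-- The bathtub principle: if weights `c k ∈ [0, 1]` have the total mass and the `μ`-average of
the indicator of the first `N` indices, and `μ` has a gap there, then they vanish beyond it. -/
lemma weight_eq_zero_of_sum_mul_eq {n N : ℕ} (hN : N ≤ n) {μ c : Fin n → ℝ} (hμ : Monotone μ)
    (hgap : ∀ i j : Fin n, (i : ℕ) < N → N ≤ (j : ℕ) → μ i < μ j)
    (hc0 : ∀ k, 0 ≤ c k) (hc1 : ∀ k, c k ≤ 1) (hcN : ∑ k, c k = N)
    (hcμ : ∑ k, μ k * c k = ∑ i : Fin N, μ (Fin.castLE hN i))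
    {k : Fin n} (hk : N ≤ (k : ℕ)) : c k = 0 := by
  rcases Nat.eq_zero_or_pos N with rfl | hpos
  · exact (Finset.sum_eq_zero_iff_of_nonneg fun k _ => hc0 k).1 (by simpa using hcN) k
      (Finset.mem_univ k)
  let l : Fin n := ⟨N - 1, by omega⟩
  have hl : (l : ℕ) < N := Nat.sub_lt hpos one_pos
  let χ : Fin n → ℝ := fun k => if (k : ℕ) < N then 1 else 0
  have hχ : ∑ k, χ k = N := by
    simpa only [one_mul, Finset.sum_const, Finset.card_univ, Fintype.card_fin, nsmul_one]
      using (Fin.sum_castLE_eq_sum_mul_ite hN fun _ => 1).symm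
  have hsum : ∑ k, (μ k - μ l) * (c k - χ k) = 0 := by
    have hμχ : ∑ k, μ k * c k = ∑ k, μ k * χ k :=
      hcμ.trans (Fin.sum_castLE_eq_sum_mul_ite hN μ)
    calc ∑ k, (μ k - μ l) * (c k - χ k)
        = (∑ k, μ k * c k - ∑ k, μ k * χ k) - μ l * (∑ k, c k - ∑ k, χ k) := by
          simp only [mul_sub, Finset.mul_sum, ← Finset.sum_sub_distrib]
          exact Finset.sum_congr rfl fun k _ => by ring
      _ = 0 := by rw [hμχ, hcN, hχ]; ring
  have hnonneg : ∀ k ∈ Finset.univ, 0 ≤ (μ k - μ l) * (c k - χ k) := by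
    intro k _
    by_cases h : (k : ℕ) < N
    · have hkl : k ≤ l := Fin.le_def.2 (Nat.le_sub_one_of_lt h)
      exact mul_nonneg_of_nonpos_of_nonpos (sub_nonpos.2 (hμ hkl)) (by simp [χ, h, hc1 k])
    · exact mul_nonneg (sub_nonneg.2 (hgap l k hl (not_lt.1 h)).le) (by simp [χ, h, hc0 k])
  have hzero := (Finset.sum_eq_zero_iff_of_nonneg hnonneg).1 hsum k (Finset.mem_univ k)
  simpa [χ, not_lt.2 hk, (sub_pos.2 (hgap l k hl hk)).ne'] using hzero

/-- The quadratic form of a symmetric map in an orthonormal eigenbasis. -/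
lemma LinearMap.IsSymmetric.inner_map_self_eq_sum_eigenvalues_mul_sq {ι E : Type*} [Fintype ι]
    [NormedAddCommGroup E] [InnerProductSpace ℝ E] {A : E →ₗ[ℝ] E} (hA : A.IsSymmetric)
    {μ : ι → ℝ} (e : OrthonormalBasis ι ℝ E) (he : ∀ k, A (e k) = μ k • e k) (x : E) :
    ⟪A x, x⟫ = ∑ k, μ k * ⟪x, e k⟫ ^ 2 := by
  rw [← e.sum_inner_mul_inner (A x) x]
  refine Finset.sum_congr rfl fun k _ => ?_
  rw [hA x (e k), he k, real_inner_smul_right, real_inner_comm x (e k)]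
  ring

/- STATEMENT 7: Under the gap condition λ_N < λ_{N+1}, any orthonormal N-tuple attaining the
minimum ∑⟨Aφ_i,φ_i⟩ = ∑_{k=1}^N λ_k spans exactly the (unique) A-invariant subspace spanned by
the eigenvectors corresponding to the N lowest eigenvalues; hence the minimizer is unique up to
orthogonal transformations. -/
theorem minimizer_spans_lowest_eigenspace
    {E : Type*} [NormedAddCommGroup E] [InnerProductSpace ℝ E] [FiniteDimensional ℝ E]
    {n : ℕ} (hn : Module.finrank ℝ E = n)
    (A : E →ₗ[ℝ] E) (hA : LinearMap.IsSymmetric A)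
    (μ : Fin n → ℝ) (hμ : Monotone μ)
    (e : OrthonormalBasis (Fin n) ℝ E) (he : ∀ k, A (e k) = μ k • e k)
    {N : ℕ} (hN : N < n)
    (hgap : ∀ i j : Fin n, (i : ℕ) < N → N ≤ (j : ℕ) → μ i < μ j)
    (Φ : Fin N → E) (hΦ : Orthonormal ℝ Φ)
    (hmin : ∑ i, ⟪A (Φ i), Φ i⟫ = ∑ i : Fin N, μ (Fin.castLE hN.le i)) :
    Submodule.span ℝ (Set.range Φ) =
      Submodule.span ℝ (Set.range (fun i : Fin N => e (Fin.castLE hN.le i))) := by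
  let c : Fin n → ℝ := fun k => ∑ i, ⟪Φ i, e k⟫ ^ 2
  have hc0 : ∀ k, 0 ≤ c k := fun k => Finset.sum_nonneg fun i _ => sq_nonneg _
  have hc1 : ∀ k, c k ≤ 1 := fun k => by
    simpa [c] using hΦ.sum_inner_products_le (e k) (s := Finset.univ)
  have hcN : ∑ k, c k = N := by
    rw [Finset.sum_comm]
    have hone : ∀ i, ∑ k, ⟪Φ i, e k⟫ ^ 2 = 1 := fun i => by
      simpa [hΦ.1 i] using e.sum_sq_norm_inner_left (Φ i)
    simp [hone]
  have hcμ : ∑ k, μ k * c k = ∑ i : Fin N, μ (Fin.castLE hN.le i) := by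
    rw [← hmin]
    simp only [c, Finset.mul_sum, hA.inner_map_self_eq_sum_eigenvalues_mul_sq e he]
    exact Finset.sum_comm
  have horth : ∀ i (k : Fin n), N ≤ (k : ℕ) → ⟪Φ i, e k⟫ = 0 := fun i k hk =>
    pow_eq_zero_iff two_ne_zero |>.1 <|
      (Finset.sum_eq_zero_iff_of_nonneg fun i _ => sq_nonneg _).1
        (weight_eq_zero_of_sum_mul_eq hN.le hμ hgap hc0 hc1 hcN hcμ hk) i (Finset.mem_univ i)
  apply Submodule.eq_of_le_of_finrank_eq
  · rw [Submodule.span_le]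
    rintro _ ⟨i, rfl⟩
    rw [SetLike.mem_coe, ← e.sum_repr' (Φ i)]
    refine Submodule.sum_mem _ fun k _ => ?_
    by_cases hk : (k : ℕ) < N
    · exact Submodule.smul_mem _ _ (Submodule.subset_span ⟨⟨k, hk⟩, rfl⟩)
    · rw [real_inner_comm, horth i k (not_lt.1 hk), zero_smul]
      exact Submodule.zero_mem _
  · exact (finrank_span_eq_card hΦ.linearIndependent).trans (finrank_span_eq_card
      (e.orthonormal.comp _ (Fin.castLE_injective hN.le)).linearIndependent).symm
end

section
/- Let A : H → H be a bounded self-adjoint operator, let ψ̃_1,…,ψ̃_N be orthonormal eigenvectors of A with Aψ̃_i = λ_i ψ̃_i and λ_1 ≤ … ≤ λ_N, let V_0 := span{ψ̃_1,…,ψ̃_N}, and assume the spectral gap condition: there exists λ > λ_N such that ⟨Ax,x⟩ ≥ λ‖x‖² for all x ∈ V_0^⊥. Let Ψ = (ψ_1,…,ψ_N) be any orthonormal N-tuple with span{ψ_1,…,ψ_N} = V_0 and set Λ := (⟨Aψ_i,ψ_j⟩)_{i,j=1}^N. Then the Hessian of the Lagrangian at the minimizer Ψ is elliptic on the tangent space: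 for every δΦ = (δφ_1,…,δφ_N) ∈ H^N with ⟨δφ_i, ψ_j⟩ = 0 for all i,j, one has ∑_{i=1}^N ⟨A δφ_i, δφ_i⟩ − ∑_{i,j=1}^N Λ_{ij} ⟨δφ_i, δφ_j⟩ ≥ (λ − λ_N) ∑_{i=1}^N ‖δφ_i‖². -/
open RealInnerProductSpace

/-- A quadratic form whose coefficient matrix is `C D Cᵀ` with `D` diagonal is a weighted sum of
squared norms. -/
theorem sum_sum_mul_inner_eq_sum_mul_norm_sq
    {ι κ H : Type*} [Fintype ι] [Fintype κ] [NormedAddCommGroup H] [InnerProductSpace ℝ H]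
    (d : κ → ℝ) (c : ι → κ → ℝ) (v : ι → H) :
    ∑ i, ∑ j, (∑ k, d k * c i k * c j k) * ⟪v i, v j⟫ = ∑ k, d k * ‖∑ i, c i k • v i‖ ^ 2 := by
  simp_rw [← real_inner_self_eq_norm_sq, sum_inner, inner_sum, real_inner_smul_left,
    real_inner_smul_right, Finset.mul_sum, Finset.sum_mul]
  simp_rw [Finset.sum_comm (s := (Finset.univ : Finset ι)) (t := (Finset.univ : Finset κ))]
  refine Finset.sum_congr rfl fun k _ => ?_
  refine Finset.sum_congr rfl fun i _ => Finset.sum_congr rfl fun j _ => ?_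
  ring

/- STATEMENT 10: Ellipticity of the Hessian of the Lagrangian on the tangent space at the
minimizer for the simplified problem, under the spectral gap condition: for all δΦ orthogonal
to the minimizing subspace, ∑⟨Aδφ_i,δφ_i⟩ − ∑ Λ_{ij}⟨δφ_i,δφ_j⟩ ≥ (λ − λ_N) ∑‖δφ_i‖². -/
theorem hessian_elliptic_on_tangent_space
    {H : Type*} [NormedAddCommGroup H] [InnerProductSpace ℝ H] [CompleteSpace H]
    (A : H →L[ℝ] H) (hA : IsSelfAdjoint A)
    {N : ℕ} (hN : 0 < N)
    (ψt : Fin N → H) (hψt : Orthonormal ℝ ψt)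
    (lam : Fin N → ℝ) (hmono : Monotone lam)
    (heig : ∀ i, A (ψt i) = lam i • ψt i)
    (μ : ℝ) (hgap : lam ⟨N - 1, Nat.sub_lt hN one_pos⟩ < μ)
    (hcoer : ∀ x ∈ (Submodule.span ℝ (Set.range ψt))ᗮ, ⟪A x, x⟫ ≥ μ * ‖x‖ ^ 2)
    (Ψ : Fin N → H) (hΨ : Orthonormal ℝ Ψ)
    (hspan : Submodule.span ℝ (Set.range Ψ) = Submodule.span ℝ (Set.range ψt))
    (Λ : Matrix (Fin N) (Fin N) ℝ) (hΛ : ∀ i j, Λ i j = ⟪A (Ψ i), Ψ j⟫) :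
    ∀ δΦ : Fin N → H, (∀ i j, ⟪δΦ i, Ψ j⟫ = 0) →
      ∑ i, ⟪A (δΦ i), δΦ i⟫ - ∑ i, ∑ j, Λ i j * ⟪δΦ i, δΦ j⟫ ≥
        (μ - lam ⟨N - 1, Nat.sub_lt hN one_pos⟩) * ∑ i, ‖δΦ i‖ ^ 2 := by
  intro δΦ hδ
  have hmem (i) : ∃ c : Fin N → ℝ, ∑ k, c k • ψt k = Ψ i :=
    (Submodule.mem_span_range_iff_exists_fun ℝ).1
      (hspan ▸ Submodule.subset_span (Set.mem_range_self i))
  choose c hc using hmem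
  have hΛc (i j) : Λ i j = ∑ k, lam k * c i k * c j k := by
    have hAΨ : A (Ψ i) = ∑ k, (lam k * c i k) • ψt k := by
      simp [← hc i, heig, smul_smul, mul_comm]
    rw [hΛ, hAΨ, ← hc j, hψt.inner_sum]
    simp
  have hone (i j) : ∑ k, 1 * c i k * c j k = if i = j then 1 else 0 := by
    rw [← orthonormal_iff_ite.1 hΨ i j, ← hc i, ← hc j, hψt.inner_sum]
    simp
  have hnorm : ∑ k, ‖∑ i, c i k • δΦ i‖ ^ 2 = ∑ i, ‖δΦ i‖ ^ 2 := by
    have h := sum_sum_mul_inner_eq_sum_mul_norm_sq (fun _ => 1) c δΦ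
    simp_rw [hone] at h
    simpa using h.symm
  have hupper : ∑ i, ∑ j, Λ i j * ⟪δΦ i, δΦ j⟫ ≤
      lam ⟨N - 1, Nat.sub_lt hN one_pos⟩ * ∑ i, ‖δΦ i‖ ^ 2 := by
    simp_rw [hΛc]
    rw [sum_sum_mul_inner_eq_sum_mul_norm_sq, ← hnorm, Finset.mul_sum]
    refine Finset.sum_le_sum fun k _ => mul_le_mul_of_nonneg_right (hmono ?_) (sq_nonneg _)
    exact Fin.mk_le_mk.2 (Nat.le_sub_one_of_lt k.2)
  have hlower : μ * ∑ i, ‖δΦ i‖ ^ 2 ≤ ∑ i, ⟪A (δΦ i), δΦ i⟫ := by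
    rw [Finset.mul_sum]
    refine Finset.sum_le_sum fun i _ => hcoer _ ?_
    rw [← hspan, Submodule.mem_orthogonal]
    intro u hu
    induction hu using Submodule.span_induction with
    | mem x hx =>
      obtain ⟨j, rfl⟩ := hx
      rw [real_inner_comm, hδ]
    | zero => simp
    | add x y _ _ hx hy => rw [inner_add_left, hx, hy, add_zero]
    | smul a x _ hx => rw [real_inner_smul_left, hx, mul_zero]
  linarith
end

section
/- Let B : H → H be a bounded self-adjoint operator satisfying θ‖x‖² ≤ ⟨Bx,x⟩ ≤ Θ‖x‖² for all x ∈ H, with constants 0 < θ ≤ Θ (so B is invertible with bounded self-adjoint inverse), and let D be an orthogonal projection on H. Then the operator Ĉ := (I − D)∘B^{-1}∘(I − D) + D is self-adjoint and satisfies min(1, 1/Θ)‖x‖² ≤ ⟨Ĉx,x⟩ ≤ max(1, 1/θ)‖x‖² for all x ∈ H; consequently Ĉ is bijective with bounded inverse B̂ := Ĉ^{-1}, which is self-adjoint (⟨B̂φ,ψ⟩ = ⟨φ,B̂ψ⟩ for all φ,ψ) and satisfies min(1, θ)‖x‖² ≤ ⟨B̂x,x⟩ ≤ max(1, Θ)‖x‖²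 for all x ∈ H, so the B̂-norm x ↦ ⟨B̂x,x⟩^{1/2} is equivalent to the norm of H. -/
open RealInnerProductSpace

/-- The inverse of an elliptic self-adjoint operator is elliptic with the reciprocal constants. -/
theorem elliptic_of_inverse {H : Type*} [NormedAddCommGroup H] [InnerProductSpace ℝ H]
    {a b : ℝ} (ha : 0 < a) (hb : 0 < b) {A A' : H →L[ℝ] H}
    (hsa : ∀ x y, ⟪A x, y⟫ = ⟪x, A y⟫)
    (hlower : ∀ x, a * ‖x‖ ^ 2 ≤ ⟪A x, x⟫) (hupper : ∀ x, ⟪A x, x⟫ ≤ b * ‖x‖ ^ 2)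
    (hinv : ∀ x, A (A' x) = x) (x : H) :
    1 / b * ‖x‖ ^ 2 ≤ ⟪A' x, x⟫ ∧ ⟪A' x, x⟫ ≤ 1 / a * ‖x‖ ^ 2 := by
  have hy : ⟪A (A' x), A' x⟫ = ⟪A' x, x⟫ := by rw [hinv, real_inner_comm]
  rw [one_div_mul_eq_div, one_div_mul_eq_div, div_le_iff₀ hb, le_div_iff₀ ha]
  constructor
  · have h : 0 ≤ ⟪A (b • A' x - x), b • A' x - x⟫ :=
      le_trans (by positivity) (hlower _)
    have hx : ⟪A x, A' x⟫ = ‖x‖ ^ 2 := by rw [hsa, hinv, real_inner_self_eq_norm_sq]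
    simp only [map_sub, map_smul, inner_sub_left, inner_sub_right, real_inner_smul_left,
      real_inner_smul_right, hy, hx] at h
    rw [hinv, real_inner_self_eq_norm_sq] at h
    have hq : 0 ≤ b * (⟪A' x, x⟫ * b - ‖x‖ ^ 2) := by linarith [hupper x]
    linarith [nonneg_of_mul_nonneg_right hq hb]
  · have h := hlower (A' x)
    rw [hy] at h
    have hn : 0 ≤ ‖x - a • A' x‖ ^ 2 := by positivity
    rw [norm_sub_sq_real, norm_smul, Real.norm_of_nonneg ha.le, real_inner_smul_right,
      real_inner_comm, mul_pow] at hn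
    nlinarith [mul_le_mul_of_nonneg_left h ha.le]

/-- A bounded operator that is bounded below by a positive constant has a bounded inverse. -/
theorem exists_inverse_of_coercive {H : Type*} [NormedAddCommGroup H] [InnerProductSpace ℝ H]
    [CompleteSpace H] {a : ℝ} (ha : 0 < a) {A : H →L[ℝ] H}
    (hlower : ∀ x, a * ‖x‖ ^ 2 ≤ ⟪A x, x⟫) :
    ∃ A' : H →L[ℝ] H, ∀ x, A (A' x) = x ∧ A' (A x) = x := by
  have hunit : IsUnit A := by
    refine ContinuousLinearMap.isUnit_of_forall_le_norm_inner_map A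
      (c := ⟨a, ha.le⟩) ha fun x => ?_
    rw [mul_comm]
    exact (hlower x).trans (le_abs_self _)
  obtain ⟨u, rfl⟩ := hunit
  exact ⟨↑u⁻¹, fun x => ⟨DFunLike.congr_fun u.mul_inv x, DFunLike.congr_fun u.inv_mul x⟩⟩

/-- A right inverse of a self-adjoint operator is self-adjoint. -/
theorem selfAdjoint_of_inverse {H : Type*} [NormedAddCommGroup H] [InnerProductSpace ℝ H]
    {A A' : H →L[ℝ] H} (hsa : ∀ x y, ⟪A x, y⟫ = ⟪x, A y⟫) (hinv : ∀ x, A (A' x) = x) (x y : H) :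
    ⟪A' x, y⟫ = ⟪x, A' y⟫ := by
  rw [← hinv y, ← hsa, hinv, hinv]

/- STATEMENT 12: For an elliptic bounded self-adjoint B (with bounded inverse B⁻¹) and an
orthogonal projection D, the operator Ĉ = (I−D)B⁻¹(I−D) + D is self-adjoint and elliptic with
constants min(1,1/Θ), max(1,1/θ); hence it has a bounded self-adjoint inverse B̂ which is
elliptic with constants min(1,θ), max(1,Θ), so the B̂-norm is equivalent to the norm of H. -/
theorem modified_preconditioner_selfadjoint_elliptic
    {H : Type*} [NormedAddCommGroup H] [InnerProductSpace ℝ H] [CompleteSpace H]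
    (θ Θ : ℝ) (hθ : 0 < θ) (hθΘ : θ ≤ Θ)
    (B : H →L[ℝ] H) (hB_sa : ∀ x y, ⟪B x, y⟫ = ⟪x, B y⟫)
    (hB_lower : ∀ x, θ * ‖x‖ ^ 2 ≤ ⟪B x, x⟫)
    (hB_upper : ∀ x, ⟪B x, x⟫ ≤ Θ * ‖x‖ ^ 2)
    (Binv : H →L[ℝ] H) (hBinv : ∀ x, B (Binv x) = x ∧ Binv (B x) = x)
    (D : H →L[ℝ] H) (hD_idem : ∀ x, D (D x) = D x)
    (hD_sa : ∀ x y, ⟪D x, y⟫ = ⟪x, D y⟫)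
    (Chat : H →L[ℝ] H)
    (hChat : Chat = (1 - D) ∘L Binv ∘L (1 - D) + D) :
    (∀ x y, ⟪Chat x, y⟫ = ⟪x, Chat y⟫) ∧
    (∀ x, min 1 (1 / Θ) * ‖x‖ ^ 2 ≤ ⟪Chat x, x⟫ ∧ ⟪Chat x, x⟫ ≤ max 1 (1 / θ) * ‖x‖ ^ 2) ∧
    (∃ Bhat : H →L[ℝ] H,
      (∀ x, Chat (Bhat x) = x ∧ Bhat (Chat x) = x) ∧
      (∀ φ ψ : H, ⟪Bhat φ, ψ⟫ = ⟪φ, Bhat ψ⟫) ∧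
      (∀ x, min 1 θ * ‖x‖ ^ 2 ≤ ⟪Bhat x, x⟫ ∧ ⟪Bhat x, x⟫ ≤ max 1 Θ * ‖x‖ ^ 2)) := by
  have hΘ : 0 < Θ := hθ.trans_le hθΘ
  have hBinv_sa := selfAdjoint_of_inverse hB_sa fun x => (hBinv x).1
  have hBinv_ell := elliptic_of_inverse hθ hΘ hB_sa hB_lower hB_upper fun x => (hBinv x).1
  have happly (x : H) : Chat x = Binv (x - D x) - D (Binv (x - D x)) + D x := by
    simp [hChat, sub_sub_sub_comm]
  have hC_inner (x y : H) :
      ⟪Chat x, y⟫ = ⟪Binv (x - D x), y - D y⟫ + ⟪D x, D y⟫ := by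
    rw [happly, inner_add_left, inner_sub_left, inner_sub_right, hD_sa (Binv _), ← hD_sa (D x) y,
      hD_idem]
  have hC_sa (x y : H) : ⟪Chat x, y⟫ = ⟪x, Chat y⟫ := by
    rw [hC_inner, ← real_inner_comm x, hC_inner, hBinv_sa, real_inner_comm (D x),
      real_inner_comm (x - D x)]
  have hpyth (x : H) : ‖x‖ ^ 2 = ‖x - D x‖ ^ 2 + ‖D x‖ ^ 2 := by
    have h : ⟪x, D x⟫ = ‖D x‖ ^ 2 := by
      rw [← real_inner_self_eq_norm_sq, hD_sa, hD_idem]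
    rw [norm_sub_sq_real, h]
    ring
  have hC_lower (x : H) : min 1 (1 / Θ) * ‖x‖ ^ 2 ≤ ⟪Chat x, x⟫ := by
    rw [hC_inner, real_inner_self_eq_norm_sq, hpyth x, mul_add]
    refine add_le_add (le_trans ?_ (hBinv_ell _).1) ?_
    · gcongr
      exact min_le_right _ _
    · exact mul_le_of_le_one_left (by positivity) (min_le_left _ _)
  have hC_upper (x : H) : ⟪Chat x, x⟫ ≤ max 1 (1 / θ) * ‖x‖ ^ 2 := by
    rw [hC_inner, real_inner_self_eq_norm_sq, hpyth x, mul_add]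
    refine add_le_add ((hBinv_ell _).2.trans ?_) ?_
    · gcongr
      exact le_max_right _ _
    · exact le_mul_of_one_le_left (by positivity) (le_max_left _ _)
  have hmin : 0 < min 1 (1 / Θ) := by positivity
  have hmax : 0 < max 1 (1 / θ) := by positivity
  obtain ⟨Bhat, hBhat⟩ := exists_inverse_of_coercive hmin hC_lower
  refine ⟨hC_sa, fun x => ⟨hC_lower x, hC_upper x⟩, Bhat, hBhat,
    selfAdjoint_of_inverse hC_sa fun x => (hBhat x).1, fun x => ?_⟩
  obtain ⟨hl, hu⟩ :=
    elliptic_of_inverse hmin hmax hC_sa hC_lower hC_upper (fun x => (hBhat x).1) x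
  constructor
  · refine le_trans ?_ hl
    gcongr
    rw [le_div_iff₀ hmax, mul_max_of_nonneg _ _ (by positivity)]
    refine max_le (by simp) ?_
    rw [mul_one_div, div_le_one hθ]
    exact min_le_right _ _
  · refine hu.trans ?_
    gcongr
    rw [div_le_iff₀ hmin, mul_min_of_nonneg _ _ (by positivity)]
    refine le_min (by simp) ?_
    rw [mul_one_div, one_le_div hΘ]
    exact le_max_right _ _
end

section
/- Let U be a real Hilbert space and let S, T' : U → U be bounded self-adjoint operators satisfying γ‖x‖² ≤ ⟨Sx,x⟩ ≤ Γ‖x‖² and θ‖x‖² ≤ ⟨T'x,x⟩ ≤ Θ‖x‖² for all x ∈ U, with constants 0 < γ ≤ Γ and 0 < θ ≤ Θ. Set α := (Γ/θ + γ/Θ)/2, T := αT', and β := (ΓΘ − γθ)/(ΓΘ + γθ) < 1. Then T is invertible with bounded inverse, and the preconditioned iteration operator I − T^{-1}S is a contraction in the T-norm: for all x ∈ U, ⟨T(x − T^{-1}Sx), x − T^{-1}Sx⟩ ≤ β² ⟨Tx,x⟩, i.e. ‖(I − T^{-1}S)x‖_T ≤ β‖x‖_T where ‖x‖_T² := ⟨Tx,x⟩.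 -/
open RealInnerProductSpace

/-- A coercive bounded operator on a real Hilbert space has a bounded two-sided inverse. -/
theorem ContinuousLinearMap.exists_inverse_of_coercive
    {U : Type*} [NormedAddCommGroup U] [InnerProductSpace ℝ U] [CompleteSpace U]
    (T : U →L[ℝ] U) {c : ℝ} (hc : 0 < c) (hT : ∀ x, c * ‖x‖ ^ 2 ≤ ⟪T x, x⟫) :
    ∃ Tinv : U →L[ℝ] U, ∀ x, T (Tinv x) = x ∧ Tinv (T x) = x := by
  let B : U →L[ℝ] U →L[ℝ] ℝ := (innerSL ℝ).comp T
  have hB : IsCoercive B := ⟨c, hc, fun x => by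
    have := hT x
    simp only [B, ContinuousLinearMap.comp_apply, innerSL_apply_apply]
    linarith [sq ‖x‖]⟩
  have hBT : ∀ x, hB.continuousLinearEquivOfBilin x = T x := fun x =>
    (hB.unique_continuousLinearEquivOfBilin (f := T x) fun w => by simp [B]).symm
  refine ⟨hB.continuousLinearEquivOfBilin.symm, fun x => ⟨?_, ?_⟩⟩
  · rw [← hBT]
    exact hB.continuousLinearEquivOfBilin.apply_symm_apply x
  · rw [← hBT]
    exact hB.continuousLinearEquivOfBilin.symm_apply_apply x

/-- If the quadratic form of a symmetric operator `D` is bounded by `β` times that of `T`, then its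
polar form is bounded by `β` times the mean of the values of the form of `T`. -/
theorem two_mul_inner_le_of_abs_inner_self_le
    {U : Type*} [NormedAddCommGroup U] [InnerProductSpace ℝ U]
    {D T : U →L[ℝ] U} {β : ℝ} (hD : ∀ x y, ⟪D x, y⟫ = ⟪x, D y⟫)
    (h : ∀ x, |⟪D x, x⟫| ≤ β * ⟪T x, x⟫) (x y : U) :
    2 * ⟪D x, y⟫ ≤ β * (⟪T x, x⟫ + ⟪T y, y⟫) := by
  have h₁ := (abs_le.mp (h (x + y))).2
  have h₂ := (abs_le.mp (h (x - y))).1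
  have h₃ : ⟪D y, x⟫ = ⟪D x, y⟫ := by rw [hD y x, real_inner_comm]
  simp only [map_add, map_sub, inner_add_left, inner_add_right, inner_sub_left,
    inner_sub_right] at h₁ h₂
  linarith

/-- If the quadratic form of a symmetric operator `D` is bounded by `β` times that of `T`, then any
solution `y` of `T y = D x` satisfies `‖y‖_T ≤ β ‖x‖_T`. -/
theorem inner_self_le_sq_mul_of_abs_inner_self_le
    {U : Type*} [NormedAddCommGroup U] [InnerProductSpace ℝ U]
    {D T : U →L[ℝ] U} {β : ℝ} (hβ : 0 ≤ β) (hD : ∀ x y, ⟪D x, y⟫ = ⟪x, D y⟫)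
    (h : ∀ x, |⟪D x, x⟫| ≤ β * ⟪T x, x⟫) {x y : U} (hxy : T y = D x) :
    ⟪T y, y⟫ ≤ β ^ 2 * ⟪T x, x⟫ := by
  rcases hβ.eq_or_lt with rfl | hβ
  · have := two_mul_inner_le_of_abs_inner_self_le hD h x y
    rw [← hxy] at this
    linarith
  · have := two_mul_inner_le_of_abs_inner_self_le hD h (β • x) y
    simp only [map_smul, real_inner_smul_left, real_inner_smul_right, ← hxy] at this
    refine le_of_mul_le_mul_left ?_ hβ
    linarith

/- STATEMENT 14: For bounded self-adjoint elliptic S, T' with constants γ ≤ Γ and θ ≤ Θ, the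
scaled operator T = αT' with α = (Γ/θ + γ/Θ)/2 is invertible, β = (ΓΘ−γθ)/(ΓΘ+γθ) < 1, and
I − T⁻¹S is a contraction in the T-norm: ‖(I − T⁻¹S)x‖_T ≤ β‖x‖_T. -/
theorem preconditioned_iteration_contraction
    {U : Type*} [NormedAddCommGroup U] [InnerProductSpace ℝ U] [CompleteSpace U]
    (γ Γ θ Θ : ℝ) (hγ : 0 < γ) (hγΓ : γ ≤ Γ) (hθ : 0 < θ) (hθΘ : θ ≤ Θ)
    (S T' : U →L[ℝ] U)
    (hS_sa : ∀ x y, ⟪S x, y⟫ = ⟪x, S y⟫) (hT'_sa : ∀ x y, ⟪T' x, y⟫ = ⟪x, T' y⟫)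
    (hS_lower : ∀ x, γ * ‖x‖ ^ 2 ≤ ⟪S x, x⟫) (hS_upper : ∀ x, ⟪S x, x⟫ ≤ Γ * ‖x‖ ^ 2)
    (hT'_lower : ∀ x, θ * ‖x‖ ^ 2 ≤ ⟪T' x, x⟫) (hT'_upper : ∀ x, ⟪T' x, x⟫ ≤ Θ * ‖x‖ ^ 2)
    (α β : ℝ) (hα : α = (Γ / θ + γ / Θ) / 2)
    (hβ : β = (Γ * Θ - γ * θ) / (Γ * Θ + γ * θ))
    (T : U →L[ℝ] U) (hT : T = α • T') :
    β < 1 ∧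
    ∃ Tinv : U →L[ℝ] U,
      (∀ x, T (Tinv x) = x ∧ Tinv (T x) = x) ∧
      ∀ x, ⟪T (x - Tinv (S x)), x - Tinv (S x)⟫ ≤ β ^ 2 * ⟪T x, x⟫ := by
  have hΘ : 0 < Θ := hθ.trans_le hθΘ
  have hΓ : 0 < Γ := hγ.trans_le hγΓ
  have hprod : γ * θ ≤ Γ * Θ := mul_le_mul hγΓ hθΘ hθ.le hΓ.le
  have hα_pos : 0 < α := by rw [hα]; positivity
  have hβ_nonneg : 0 ≤ β := by
    rw [hβ]
    exact div_nonneg (by linarith) (by positivity)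
  have hβ_lt : β < 1 := by
    rw [hβ, div_lt_one (by positivity)]
    linarith [mul_pos hγ hθ]
  have hupper : (1 + β) * α = Γ / θ := by
    rw [hα, hβ]
    field_simp
    ring
  have hlower : (1 - β) * α = γ / Θ := by
    rw [hα, hβ]
    field_simp
    ring
  have hT_apply : ∀ x, ⟪T x, x⟫ = α * ⟪T' x, x⟫ := fun x => by
    rw [hT, smul_apply, real_inner_smul_left]
  have hD_sa : ∀ x y, ⟪(T - S) x, y⟫ = ⟪x, (T - S) y⟫ := fun x y => by
    simp only [hT, sub_apply, smul_apply, inner_sub_left,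
      inner_sub_right, real_inner_smul_left, real_inner_smul_right, hS_sa, hT'_sa]
  have hD : ∀ x, |⟪(T - S) x, x⟫| ≤ β * ⟪T x, x⟫ := fun x => by
    have h₁ : ⟪S x, x⟫ ≤ (1 + β) * ⟪T x, x⟫ := by
      rw [hT_apply, ← mul_assoc, hupper]
      calc ⟪S x, x⟫ ≤ Γ * ‖x‖ ^ 2 := hS_upper x
        _ = Γ / θ * (θ * ‖x‖ ^ 2) := by field_simp
        _ ≤ Γ / θ * ⟪T' x, x⟫ := by gcongr; exact hT'_lower x
    have h₂ : (1 - β) * ⟪T x, x⟫ ≤ ⟪S x, x⟫ := by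
      rw [hT_apply, ← mul_assoc, hlower]
      calc γ / Θ * ⟪T' x, x⟫ ≤ γ / Θ * (Θ * ‖x‖ ^ 2) := by gcongr; exact hT'_upper x
        _ = γ * ‖x‖ ^ 2 := by field_simp
        _ ≤ ⟪S x, x⟫ := hS_lower x
    rw [sub_apply, inner_sub_left, abs_le]
    constructor <;> linarith
  obtain ⟨Tinv, hTinv⟩ := T.exists_inverse_of_coercive (mul_pos hα_pos hθ) fun x => by
    rw [hT_apply, mul_assoc]
    exact mul_le_mul_of_nonneg_left (hT'_lower x) hα_pos.le
  refine ⟨hβ_lt, Tinv, hTinv, fun x => ?_⟩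
  refine inner_self_le_sq_mul_of_abs_inner_self_le hβ_nonneg hD_sa hD ?_
  rw [map_sub, (hTinv (S x)).1, sub_apply]
end
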